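/- G₂(x) > 0 for all x > 0, where G₂(x) = 2 + Σ_{n=1}^∞ (xⁿ/n!)·(t_n − 2/(n+1)) and t_n = ∫₀¹ sⁿ τ₀(1−s) ds; consequently the function x ↦ −h₂″(x)/h₂′(x) is completely monotonic on (0,∞), i.e., h₂′ is logarithmically completely monotonic, where h₂(x) = exp(2x·log(1 + 1/x)). -/

import Mathlib

/-- A function `u : ℝ → ℝ` is completely monotonic on `(0,∞)` if it is infinitely
differentiable there and `(-1)^n u^{(n)}(x) ≥ 0` for all `x > 0` and all `n ≥ 0`. -/
def CompletelyMonotonicOn (u : ℝ → ℝ) : Prop :=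
  ContDiffOn ℝ (⊤ : ℕ∞) u (Set.Ioi 0) ∧
  ∀ (n : ℕ), ∀ x ∈ Set.Ioi (0 : ℝ), 0 ≤ (-1 : ℝ) ^ n * iteratedDerivWithin n u (Set.Ioi 0) x

/-- `h_α(x) = exp(αx·log(1 + 1/x))`. -/
noncomputable def hfun (α : ℝ) (x : ℝ) : ℝ := Real.exp (α * x * Real.log (1 + 1 / x))

/-- The density `τ₀(t) = ( t[(1−t)log((1−t)/t) − 1]² + π² t (1−t)² )⁻¹` for `0 < t < 1`. -/
noncomputable def tau0 (t : ℝ) : ℝ :=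
  (t * ((1 - t) * Real.log ((1 - t) / t) - 1) ^ 2 + Real.pi ^ 2 * t * (1 - t) ^ 2)⁻¹

/-- The moments `t_n = ∫₀¹ sⁿ τ₀(1−s) ds`. -/
noncomputable def tmom (n : ℕ) : ℝ := ∫ s in (0 : ℝ)..1, s ^ n * tau0 (1 - s)

/-- `G_α(x) = 2 + Σ_{n=1}^∞ (xⁿ/n!)·(t_n − α/(n+1))`. -/
noncomputable def Gfun (α : ℝ) (x : ℝ) : ℝ :=
  2 + ∑' n : ℕ, x ^ (n + 1) / (Nat.factorial (n + 1) : ℝ) *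
    (tmom (n + 1) - α / ((n : ℝ) + 2))


open Filter Topology MeasureTheory

theorem tendsto_im_integral_top_of_strip {g : ℂ → ℂ} {A B : ℂ}
    (hd : ∀ z : ℂ, 0 ≤ z.im → z.im ≤ Real.pi → DifferentiableAt ℂ g z)
    (hreal : ∀ x : ℝ, (g x).im = 0)
    (hA : Tendsto g (comap Complex.re atTop ⊓ 𝓟 {z | 0 ≤ z.im ∧ z.im ≤ Real.pi}) (𝓝 A))
    (hB : Tendsto g (comap Complex.re atBot ⊓ 𝓟 {z | 0 ≤ z.im ∧ z.im ≤ Real.pi}) (𝓝 B)) :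
    Tendsto (fun R : ℝ => ∫ x in -R..R, (g (x + Real.pi * Complex.I)).im) atTop
      (𝓝 (Real.pi * (A.re - B.re))) := by
  have hπ := Real.pi_pos
  have side : ∀ (l : Filter ℝ) [l.IsCountablyGenerated] (C : ℂ),
      Tendsto g (comap Complex.re l ⊓ 𝓟 {z | 0 ≤ z.im ∧ z.im ≤ Real.pi}) (𝓝 C) →
      Tendsto (fun R : ℝ => ∫ y in (0:ℝ)..Real.pi, g (R + y * Complex.I)) l
        (𝓝 (Real.pi * C)) := by
    intro l _ C hC
    have h1 : Tendsto (fun R : ℝ => ∫ y in (0:ℝ)..Real.pi, g (R + y * Complex.I)) l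
        (𝓝 (∫ y in (0:ℝ)..Real.pi, C)) := by
      apply intervalIntegral.tendsto_integral_filter_of_dominated_convergence (fun _ => ‖C‖ + 1)
      · refine Eventually.of_forall fun R => ?_
        apply ContinuousOn.aestronglyMeasurable _ measurableSet_uIoc
        intro y hy
        rw [Set.uIoc_of_le hπ.le] at hy
        have h2 : ContinuousAt g ((R : ℂ) + y * Complex.I) :=
          (hd _ (by simpa using hy.1.le) (by simpa using hy.2)).continuousAt
        have h3 : ContinuousAt (fun y : ℝ => g ((R : ℂ) + y * Complex.I)) y :=
          ContinuousAt.comp (f := fun y : ℝ => (R : ℂ) + y * Complex.I) h2 (by fun_prop)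
        exact h3.continuousWithinAt
      · have h2 : ∀ᶠ z in comap Complex.re l ⊓ 𝓟 {z | 0 ≤ z.im ∧ z.im ≤ Real.pi},
            ‖g z‖ ≤ ‖C‖ + 1 := hC.norm.eventually (eventually_le_nhds (by linarith))
        rw [eventually_inf_principal, eventually_comap] at h2
        filter_upwards [h2] with R hR
        refine Eventually.of_forall fun y hy => ?_
        rw [Set.uIoc_of_le hπ.le] at hy
        exact hR _ (by simp) ⟨by simpa using hy.1.le, by simpa using hy.2⟩
      · simp
      · refine Eventually.of_forall fun y hy => ?_
        rw [Set.uIoc_of_le hπ.le] at hy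
        refine hC.comp (tendsto_inf.2 ⟨?_, ?_⟩)
        · rw [tendsto_comap_iff]
          refine tendsto_id.congr fun R => ?_
          simp
        · rw [tendsto_principal]
          exact Eventually.of_forall fun R => ⟨by simpa using hy.1.le, by simpa using hy.2⟩
    simpa using h1
  have hR := Complex.continuous_re.continuousAt.tendsto.comp (side atTop A hA)
  have hL := Complex.continuous_re.continuousAt.tendsto.comp
    ((side atBot B hB).comp tendsto_neg_atTop_atBot)
  have := hR.sub hL
  have e : (Real.pi * A).re - (Real.pi * B).re = Real.pi * (A.re - B.re) := by
    simp; ring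
  rw [e] at this
  refine this.congr' ?_
  filter_upwards [eventually_gt_atTop 0] with R hR0
  have hc := Complex.integral_boundary_rect_eq_zero_of_differentiableOn g (-R : ℂ)
    (R + Real.pi * Complex.I) (by
      intro z hz
      rw [Complex.mem_reProdIm] at hz
      have h2 := hz.2
      simp only [Complex.neg_im, Complex.ofReal_im, neg_zero, Complex.add_im, Complex.mul_im,
        Complex.ofReal_re, Complex.I_im, mul_one, Complex.I_re, mul_zero, add_zero, zero_add,
        Set.uIcc_of_le hπ.le] at h2
      exact (hd z h2.1 h2.2).differentiableWithinAt)
  have hb : (∫ x in -R..R, g x).im = 0 := by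
    have : (∫ x in -R..R, g x) = ((∫ x in -R..R, (g x).re : ℝ) : ℂ) := by
      rw [← intervalIntegral.integral_ofReal]
      congr 1
      ext x
      exact Complex.ext (by simp) (by simp [hreal])
    rw [this]; simp
  have ht : (∫ x in -R..R, g (x + Real.pi * Complex.I)).im
      = ∫ x in -R..R, (g (x + Real.pi * Complex.I)).im := by
    have hi : IntervalIntegrable (fun x : ℝ => g (x + Real.pi * Complex.I)) volume (-R) R := by
      apply Continuous.intervalIntegrable
      rw [continuous_iff_continuousAt]
      intro x
      have h2 : ContinuousAt g ((x : ℂ) + Real.pi * Complex.I) :=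
          (hd _ (by simpa using hπ.le) (by simp)).continuousAt
      exact ContinuousAt.comp (f := fun x : ℝ => (x : ℂ) + Real.pi * Complex.I) h2 (by fun_prop)
    exact (Complex.imCLM.intervalIntegral_comp_comm hi).symm
  simp at hc
  have := congrArg Complex.im hc
  simp [hb, ht] at this
  simp
  linarith

/-- The entire function `(exp z - 1) / z`. -/
noncomputable def expQuot : ℂ → ℂ := dslope Complex.exp 0

/-- The entire function `(exp z - 1 - z) / z ^ 2`. -/
noncomputable def expQuot₂ : ℂ → ℂ := dslope expQuot 0

theorem differentiable_expQuot : Differentiable ℂ expQuot := by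
  rw [← differentiableOn_univ]
  exact (Complex.differentiableOn_dslope univ_mem).2 Complex.differentiable_exp.differentiableOn

theorem differentiable_expQuot₂ : Differentiable ℂ expQuot₂ := by
  rw [← differentiableOn_univ]
  exact (Complex.differentiableOn_dslope univ_mem).2 differentiable_expQuot.differentiableOn

theorem expQuot_zero : expQuot 0 = 1 := by
  simp [expQuot]

theorem mul_expQuot (z : ℂ) : z * expQuot z = Complex.exp z - 1 := by
  have := sub_smul_dslope Complex.exp 0 z
  simpa [expQuot] using this

theorem sq_mul_expQuot₂ (z : ℂ) : z ^ 2 * expQuot₂ z = Complex.exp z - 1 - z := by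
  have := sub_smul_dslope expQuot 0 z
  simp only [sub_zero, smul_eq_mul, expQuot_zero] at this
  have h2 := mul_expQuot z
  change z * expQuot₂ z = _ at this
  linear_combination z * this + h2

theorem expQuot₂_zero : expQuot₂ 0 = 1 / 2 := by
  have h0 : expQuot₂ 0 = deriv expQuot 0 := by simp [expQuot₂]
  have hd : Differentiable ℂ (deriv expQuot) := differentiable_expQuot.deriv
  have h1 : ∀ z, expQuot z + z * deriv expQuot z = Complex.exp z := by
    intro z
    have a : HasDerivAt (fun z => z * expQuot z) (1 * expQuot z + z * deriv expQuot z) z :=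
      (hasDerivAt_id z).mul (differentiable_expQuot z).hasDerivAt
    have b : HasDerivAt (fun z => z * expQuot z) (Complex.exp z) z := by
      simp_rw [mul_expQuot]
      exact (Complex.hasDerivAt_exp z).sub_const 1
    have := a.unique b
    simpa using this
  have a : HasDerivAt (fun z => expQuot z + z * deriv expQuot z)
      (deriv expQuot 0 + (1 * deriv expQuot 0 + 0 * deriv (deriv expQuot) 0)) 0 :=
    (differentiable_expQuot 0).hasDerivAt.add ((hasDerivAt_id (0:ℂ)).mul (hd 0).hasDerivAt)
  have b : HasDerivAt (fun z => expQuot z + z * deriv expQuot z) (Complex.exp 0) 0 := by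
    simp_rw [h1]
    exact Complex.hasDerivAt_exp 0
  have := a.unique b
  rw [Complex.exp_zero] at this
  rw [h0]
  linear_combination this / 2

theorem expQuot_ne_zero {z : ℂ} (h0 : 0 ≤ z.im) (h1 : z.im ≤ Real.pi) : expQuot z ≠ 0 := by
  intro h
  have h2 := mul_expQuot z
  rw [h, mul_zero, eq_comm, sub_eq_zero] at h2
  obtain ⟨n, hn⟩ := Complex.exp_eq_one_iff.1 h2
  have h3 : z.im = n * (2 * Real.pi) := by simp [hn]
  have h4 : n = 0 := by
    have hp := Real.pi_pos
    have a : (n : ℝ) < 1 := by nlinarith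
    have b : (-1 : ℝ) < n := by nlinarith
    have a' : n < 1 := by exact_mod_cast a
    have b' : -1 < n := by exact_mod_cast b
    omega
  rw [hn, h4] at h
  simp [expQuot_zero] at h

theorem expQuot₂_ne_zero {z : ℂ} (h0 : 0 ≤ z.im) (h1 : z.im ≤ Real.pi) : expQuot₂ z ≠ 0 := by
  intro h
  have h2 := sq_mul_expQuot₂ z
  rw [h, mul_zero] at h2
  have hre := congrArg Complex.re h2
  have him := congrArg Complex.im h2
  simp [Complex.exp_re, Complex.exp_im] at hre him
  rcases h0.eq_or_lt with hb | hb
  · have hz : z.re = 0 := by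
      by_contra hne
      have := Real.add_one_lt_exp hne
      rw [← hb] at hre
      simp at hre
      linarith
    have : z = 0 := Complex.ext hz hb.symm
    rw [this, expQuot₂_zero] at h
    norm_num at h
  · have hpos := Real.exp_pos z.re
    have hs : 0 < Real.sin z.im := by
      by_contra hn
      nlinarith [mul_nonpos_of_nonneg_of_nonpos hpos.le (not_lt.1 hn)]
    have hlt := Real.sin_lt hb
    have ha : 0 < z.re := by
      rw [← Real.one_lt_exp_iff]
      nlinarith
    have hc : 0 < Real.cos z.im := by
      by_contra hn
      nlinarith [mul_nonpos_of_nonneg_of_nonpos hpos.le (not_lt.1 hn)]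
    have hb2 : z.im < Real.pi / 2 := by
      by_contra hn
      have := Real.cos_nonpos_of_pi_div_two_le_of_le (not_lt.1 hn) (by linarith)
      linarith
    have ht := Real.lt_tan hb hb2
    rw [Real.tan_eq_sin_div_cos, lt_div_iff₀ hc] at ht
    nlinarith [mul_lt_mul_of_pos_left ht hpos]

theorem expQuot_ofReal_im (x : ℝ) : (expQuot x).im = 0 := by
  rcases eq_or_ne x 0 with rfl | h
  · simp [expQuot_zero]
  have : expQuot x = (((Real.exp x - 1) / x : ℝ) : ℂ) := by
    have h' : (x : ℂ) ≠ 0 := by exact_mod_cast h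
    push_cast
    rw [eq_div_iff h', mul_comm, mul_expQuot]
  rw [this, Complex.ofReal_im]

theorem expQuot₂_ofReal_im (x : ℝ) : (expQuot₂ x).im = 0 := by
  rcases eq_or_ne x 0 with rfl | h
  · simp [expQuot₂_zero]
  have : expQuot₂ x = (((Real.exp x - 1 - x) / x ^ 2 : ℝ) : ℂ) := by
    have h' : (x : ℂ) ^ 2 ≠ 0 := by exact_mod_cast pow_ne_zero 2 h
    push_cast
    rw [eq_div_iff h', mul_comm, sq_mul_expQuot₂]
  rw [this, Complex.ofReal_im]

theorem tendsto_strip_atTop (u : ℝ) :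
    Tendsto (fun z : ℂ => (Complex.exp z - 1) ^ 2 /
        ((Complex.exp u - Complex.exp z) * (Complex.exp z - 1 - z)))
      (comap Complex.re atTop ⊓ 𝓟 {z | 0 ≤ z.im ∧ z.im ≤ Real.pi}) (𝓝 (-1)) := by
  set l := comap Complex.re atTop ⊓ 𝓟 {z : ℂ | 0 ≤ z.im ∧ z.im ≤ Real.pi} with hl
  have hre : Tendsto Complex.re l atTop := tendsto_comap.mono_left inf_le_left
  have hS : ∀ᶠ z in l, 0 ≤ z.im ∧ z.im ≤ Real.pi :=
    (eventually_principal.2 fun _ h => h).filter_mono inf_le_right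
  have he : Tendsto (fun z => Complex.exp (-z)) l (𝓝 0) := by
    rw [tendsto_zero_iff_norm_tendsto_zero]
    simp only [Complex.norm_exp, Complex.neg_re]
    exact Real.tendsto_exp_neg_atTop_nhds_zero.comp hre
  have hze : Tendsto (fun z => z * Complex.exp (-z)) l (𝓝 0) := by
    have hb : Tendsto (fun a : ℝ => a ^ 1 * Real.exp (-a) + Real.pi * Real.exp (-a)) atTop
        (𝓝 (0 + Real.pi * 0)) :=
      (Real.tendsto_pow_mul_exp_neg_atTop_nhds_zero 1).add
        (Real.tendsto_exp_neg_atTop_nhds_zero.const_mul _)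
    rw [mul_zero, add_zero] at hb
    refine squeeze_zero_norm' ?_ (hb.comp hre)
    filter_upwards [hS, hre.eventually_ge_atTop 0] with z hz hz0
    rw [norm_mul, Complex.norm_exp]
    have := Complex.norm_le_abs_re_add_abs_im z
    rw [abs_of_nonneg hz0, abs_of_nonneg hz.1] at this
    simp only [Complex.neg_re, Function.comp, pow_one]
    rw [← add_mul]
    gcongr
    linarith [hz.2]
  have key : Tendsto (fun z : ℂ => (1 - Complex.exp (-z)) ^ 2 /
      ((Complex.exp u * Complex.exp (-z) - 1) * (1 - Complex.exp (-z) - z * Complex.exp (-z)))) l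
      (𝓝 ((1 - 0) ^ 2 / ((Complex.exp u * 0 - 1) * (1 - 0 - 0)))) := by
    refine Tendsto.div ((tendsto_const_nhds.sub he).pow 2) (Tendsto.mul
      ((he.const_mul _).sub tendsto_const_nhds) ((tendsto_const_nhds.sub he).sub hze)) ?_
    norm_num
  norm_num at key
  refine key.congr fun z => ?_
  have hne : Complex.exp (-z) ≠ 0 := Complex.exp_ne_zero _
  have h1 : Complex.exp z * Complex.exp (-z) = 1 := by rw [← Complex.exp_add]; simp
  rw [← mul_div_mul_right ((Complex.exp z - 1) ^ 2) _ (pow_ne_zero 2 hne)]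
  congr 1
  · linear_combination (-Complex.exp z * Complex.exp (-z) - 1 + 2 * Complex.exp (-z)) * h1
  · linear_combination (-(Complex.exp u * Complex.exp (-z) - 1 )+ Complex.exp z * Complex.exp (-z)
       - Complex.exp (-z)- z * Complex.exp (-z)) * h1

theorem tendsto_sub_cobounded_of_re {l : Filter ℂ} (w : ℂ)
    (h : Tendsto (fun z : ℂ => |z.re|) l atTop) :
    Tendsto (fun z : ℂ => z - w) l (Bornology.cobounded ℂ) := by
  rw [← tendsto_norm_atTop_iff_cobounded]
  refine tendsto_atTop_mono (f := fun z : ℂ => |z.re| - |w.re|) (fun z => ?_)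
    (tendsto_atTop_add_const_right _ _ h)
  calc |z.re| - |w.re| ≤ |z.re - w.re| := abs_sub_abs_le_abs_sub _ _
    _ = |(z - w).re| := by simp
    _ ≤ ‖z - w‖ := Complex.abs_re_le_norm _

theorem tendsto_strip_atBot (u : ℝ) :
    Tendsto (fun z : ℂ => (Complex.exp z - 1) ^ 2 /
        ((Complex.exp u - Complex.exp z) * (Complex.exp z - 1 - z)))
      (comap Complex.re atBot ⊓ 𝓟 {z | 0 ≤ z.im ∧ z.im ≤ Real.pi}) (𝓝 0) := by
  set l := comap Complex.re atBot ⊓ 𝓟 {z : ℂ | 0 ≤ z.im ∧ z.im ≤ Real.pi} with hl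
  have hre : Tendsto Complex.re l atBot := tendsto_comap.mono_left inf_le_left
  have he : Tendsto (fun z => Complex.exp z) l (𝓝 0) := by
    rw [tendsto_zero_iff_norm_tendsto_zero]
    simp only [Complex.norm_exp]
    exact Real.tendsto_exp_atBot.comp hre
  have hinv : Tendsto (fun z : ℂ => (z - (-1))⁻¹) l (𝓝 0) :=
    tendsto_inv₀_cobounded.comp
      (tendsto_sub_cobounded_of_re (-1) (tendsto_abs_atBot_atTop.comp hre))
  have key : Tendsto (fun z : ℂ => (Complex.exp z - 1) ^ 2 /
      ((Complex.exp u - Complex.exp z) * (Complex.exp z * (z - (-1))⁻¹ - 1)) * (z - (-1))⁻¹) l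
      (𝓝 ((0 - 1) ^ 2 / ((Complex.exp u - 0) * (0 * 0 - 1)) * 0)) := by
    refine Tendsto.mul (Tendsto.div ((he.sub tendsto_const_nhds).pow 2) (Tendsto.mul
      (tendsto_const_nhds.sub he) ((he.mul hinv).sub tendsto_const_nhds)) ?_) hinv
    simp
  rw [mul_zero] at key
  refine key.congr' ?_
  filter_upwards [hre.eventually_lt_atBot (-1)] with z hz
  have hne : z - (-1) ≠ 0 := fun h => by
    have := congrArg Complex.re h
    simp at this
    linarith
  have hne' := inv_ne_zero hne
  have h1 : (z - (-1)) * (z - (-1))⁻¹ = 1 := mul_inv_cancel₀ hne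
  rw [← mul_div_mul_right _ ((Complex.exp u - Complex.exp z) * (Complex.exp z - 1 - z)) hne',
    div_mul_eq_mul_div]
  congr 1
  linear_combination (Complex.exp u - Complex.exp z) * h1


theorem integrable_and_integral_kernel {u : ℝ} (hu : u < 0) :
    Integrable (fun x : ℝ => (1 + Real.exp x) ^ 2 /
      ((Real.exp u + Real.exp x) * ((x + 1 + Real.exp x) ^ 2 + Real.pi ^ 2))) ∧
    ∫ x : ℝ, (1 + Real.exp x) ^ 2 /
      ((Real.exp u + Real.exp x) * ((x + 1 + Real.exp x) ^ 2 + Real.pi ^ 2)) =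
      (1 - Real.exp u) ^ 2 / (Real.exp u * (Real.exp u - 1 - u)) - 1 := by
  set K : ℝ → ℝ := fun x => (1 + Real.exp x) ^ 2 /
      ((Real.exp u + Real.exp x) * ((x + 1 + Real.exp x) ^ 2 + Real.pi ^ 2)) with hK
  have hπ := Real.pi_pos
  set H : ℂ → ℂ := fun z => -(expQuot z) ^ 2 /
    (Complex.exp u * expQuot (z - u) * expQuot₂ z) with hH
  set r : ℝ := -(1 - Real.exp u) ^ 2 / (Real.exp u * (Real.exp u - 1 - u)) with hr
  have hu' : (u : ℂ) ≠ 0 := by exact_mod_cast hu.ne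
  have hq : Real.exp u - 1 - u ≠ 0 := by
    have := Real.add_one_lt_exp hu.ne
    linarith
  have hHu : H u = r := by
    have h1 : expQuot u = (Complex.exp u - 1) / u := by
      rw [eq_div_iff hu', mul_comm, mul_expQuot]
    have h2 : expQuot₂ u = (Complex.exp u - 1 - u) / u ^ 2 := by
      rw [eq_div_iff (pow_ne_zero 2 hu'), mul_comm, sq_mul_expQuot₂]
    have hq' : Complex.exp u - 1 - u ≠ 0 := by exact_mod_cast hq
    simp only [hH, hr]
    rw [sub_self, expQuot_zero, h1, h2]
    push_cast
    have := Complex.exp_ne_zero (u : ℂ)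
    field_simp
    ring
  have hHd : ∀ z : ℂ, 0 ≤ z.im → z.im ≤ Real.pi → DifferentiableAt ℂ H z := by
    intro z h0 h1
    have a := differentiable_expQuot z
    have b : DifferentiableAt ℂ (fun z => expQuot (z - u)) z :=
      DifferentiableAt.comp z (differentiable_expQuot (z - u)) (by fun_prop)
    have c := differentiable_expQuot₂ z
    refine DifferentiableAt.div (a.pow 2).neg ((b.const_mul _).mul c) ?_
    refine mul_ne_zero (mul_ne_zero (Complex.exp_ne_zero _) (expQuot_ne_zero ?_ ?_))
      (expQuot₂_ne_zero h0 h1) <;> simpa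
  set g : ℂ → ℂ := dslope H u with hg
  have hgd : ∀ z : ℂ, 0 ≤ z.im → z.im ≤ Real.pi → DifferentiableAt ℂ g z := by
    intro z h0 h1
    rcases eq_or_ne z u with rfl | hz
    · have ho : ∀ᶠ z in 𝓝 (u : ℂ), DifferentiableAt ℂ H z := by
        have hb : ∀ᶠ z in 𝓝 (u : ℂ), expQuot (z - u) ≠ 0 ∧ expQuot₂ z ≠ 0 := by
          have c1 : ContinuousAt (fun z => expQuot (z - u)) u :=
            (differentiable_expQuot.continuous.comp (continuous_id.sub continuous_const)).continuousAt
          have c2 : ContinuousAt expQuot₂ u := differentiable_expQuot₂.continuous.continuousAt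
          exact (c1.eventually_ne (by simp [expQuot_zero])).and
            (c2.eventually_ne (expQuot₂_ne_zero (by simp) (by simpa using hπ.le)))
        filter_upwards [hb] with z hz
        have a := differentiable_expQuot z
        have b : DifferentiableAt ℂ (fun z => expQuot (z - u)) z :=
          DifferentiableAt.comp z (differentiable_expQuot (z - u)) (by fun_prop)
        exact DifferentiableAt.div (a.pow 2).neg ((b.const_mul _).mul (differentiable_expQuot₂ z))
          (mul_ne_zero (mul_ne_zero (Complex.exp_ne_zero _) hz.1) hz.2)
      have : DifferentiableOn ℂ H {z | DifferentiableAt ℂ H z} :=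
        fun z hz => hz.differentiableWithinAt
      exact ((Complex.differentiableOn_dslope ho).2 this).differentiableAt ho
    · exact (differentiableAt_dslope_of_ne hz).2 (hHd z h0 h1)
  have hgs : ∀ z : ℂ, z ≠ u → g z = (H z - r) / (z - u) := by
    intro z hz
    rw [hg, dslope_of_ne _ hz, slope_def_field, hHu]
  have hgf : ∀ z : ℂ, z ≠ u → z ≠ 0 → g z = (Complex.exp z - 1) ^ 2 /
        ((Complex.exp u - Complex.exp z) * (Complex.exp z - 1 - z)) - r / (z - u) := by
    intro z hz hz0
    have hzu := sub_ne_zero.2 hz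
    rw [hgs z hz, sub_div]
    congr 1
    have h3 := mul_expQuot (z - u)
    have h4 : Complex.exp u - Complex.exp z
        = -(Complex.exp u * ((z - u) * expQuot (z - u))) := by
      rw [h3, mul_sub, ← Complex.exp_add]
      simp
    rw [h4, ← sq_mul_expQuot₂, ← mul_expQuot]
    simp only [hH]
    rw [div_div, ← mul_div_mul_right (-expQuot z ^ 2) _ (pow_ne_zero 2 hz0), ← neg_div_neg_eq]
    congr 1 <;> ring
  have hHim : ∀ x : ℝ, (H x).im = 0 := by
    intro x
    have e1 : expQuot x = ((expQuot x).re : ℂ) :=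
      Complex.ext (by simp) (by simp [expQuot_ofReal_im])
    have e2 : expQuot₂ x = ((expQuot₂ x).re : ℂ) :=
      Complex.ext (by simp) (by simp [expQuot₂_ofReal_im])
    have e3 : expQuot (x - u) = ((expQuot (x - u)).re : ℂ) := by
      have := expQuot_ofReal_im (x - u)
      push_cast at this
      exact Complex.ext (by simp) (by simp [this])
    simp only [hH]
    rw [e1, e2, e3, ← Complex.ofReal_exp]
    norm_cast
  have hgim : ∀ x : ℝ, (g x).im = 0 := by
    have hc : Continuous fun x : ℝ => (g x).im := by
      rw [continuous_iff_continuousAt]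
      intro x
      exact Complex.continuous_im.continuousAt.comp (ContinuousAt.comp (f := fun x : ℝ => (x : ℂ))
        (hgd x (by simp) (by simpa using hπ.le)).continuousAt Complex.continuous_ofReal.continuousAt)
    have := hc.ext_on (dense_compl_singleton u) continuous_const (g := fun _ => (0 : ℝ)) (by
      intro x hx
      have hx' : (x : ℂ) ≠ u := by exact_mod_cast hx
      have e : H x = ((H x).re : ℂ) := Complex.ext (by simp) (by simp [hHim])
      simp only
      rw [hgs _ hx', e]
      norm_cast)
    exact fun x => congrFun this x
  have hlim : ∀ (l : Filter ℝ) (A : ℂ), Tendsto (fun x : ℝ => |x|) l atTop →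
      Tendsto (fun z : ℂ => (Complex.exp z - 1) ^ 2 /
        ((Complex.exp u - Complex.exp z) * (Complex.exp z - 1 - z)))
        (comap Complex.re l ⊓ 𝓟 {z | 0 ≤ z.im ∧ z.im ≤ Real.pi}) (𝓝 A) →
      Tendsto g (comap Complex.re l ⊓ 𝓟 {z | 0 ≤ z.im ∧ z.im ≤ Real.pi}) (𝓝 A) := by
    intro l A hl hf
    have hre : Tendsto Complex.re (comap Complex.re l ⊓ 𝓟 {z | 0 ≤ z.im ∧ z.im ≤ Real.pi}) l :=
      tendsto_comap.mono_left inf_le_left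
    have h1 := tendsto_inv₀_cobounded.comp (tendsto_sub_cobounded_of_re (u : ℂ) (hl.comp hre))
    have h2 := hf.sub (h1.const_mul (r : ℂ))
    rw [mul_zero, sub_zero] at h2
    refine h2.congr' ?_
    filter_upwards [(hl.comp hre).eventually_gt_atTop |u|] with z hz
    rw [hgf z, div_eq_mul_inv (r : ℂ)]
    · rfl
    · rintro rfl
      simp at hz
    · rintro rfl
      simp at hz
      exact absurd hz (not_lt.2 (abs_nonneg _))
  have hmain := tendsto_im_integral_top_of_strip hgd hgim
    (hlim atTop (-1) tendsto_abs_atTop_atTop (tendsto_strip_atTop u))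
    (hlim atBot 0 tendsto_abs_atBot_atTop (tendsto_strip_atBot u))
  have himg : ∀ x : ℝ, (g (x + Real.pi * Complex.I)).im =
      Real.pi * K x + r * (Real.pi / ((x - u) ^ 2 + Real.pi ^ 2)) := by
    intro x
    have hne : ∀ y : ℝ, (x : ℂ) + Real.pi * Complex.I ≠ y := fun y h => by
      have := congrArg Complex.im h
      simp at this
    rw [hgf _ (hne u) (by simpa using hne 0), Complex.exp_add, Complex.exp_pi_mul_I, Complex.sub_im]
    have e1 : ((Complex.exp x * -1 - 1) ^ 2 / ((Complex.exp u - Complex.exp x * -1) *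
        (Complex.exp x * -1 - 1 - (x + Real.pi * Complex.I)))).im = Real.pi * K x := by
      have hz : Complex.exp x * -1 - 1 - (x + Real.pi * Complex.I)
        = -(((x + 1 + Real.exp x : ℝ) : ℂ) + Real.pi * Complex.I) := by
        push_cast; ring
      have hy : (Complex.exp x * -1 - 1) ^ 2 = (((1 + Real.exp x) ^ 2 : ℝ) : ℂ) := by
        push_cast; ring
      have hw : Complex.exp u - Complex.exp x * -1 = ((Real.exp u + Real.exp x : ℝ) : ℂ) := by
        push_cast; ring
      rw [hz, hy, hw, ← div_div, ← Complex.ofReal_div, div_eq_mul_inv, Complex.im_ofReal_mul,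
        Complex.inv_im]
      simp only [hK, Complex.normSq_apply]
      simp [Complex.exp_ofReal_re]
      rw [← div_div, div_eq_mul_inv _ ((x + 1 + Real.exp x) ^ 2 + Real.pi ^ 2),
        ← pow_two, ← pow_two]
      ring
    have e2 : ((r : ℂ) / (x + Real.pi * Complex.I - u)).im =
        -(r * (Real.pi / ((x - u) ^ 2 + Real.pi ^ 2))) := by
      rw [div_eq_mul_inv, Complex.im_ofReal_mul, Complex.inv_im, Complex.normSq_apply]
      simp
      ring
    rw [e1, e2]
    ring
  have hP : Integrable (fun x : ℝ => Real.pi / ((x - u) ^ 2 + Real.pi ^ 2)) ∧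
      ∫ x : ℝ, Real.pi / ((x - u) ^ 2 + Real.pi ^ 2) = Real.pi := by
    have e : (fun x : ℝ => Real.pi / ((x - u) ^ 2 + Real.pi ^ 2)) =
        fun x => Real.pi⁻¹ * (1 + ((x - u) / Real.pi) ^ 2)⁻¹ := by
      ext x
      have : (x - u) ^ 2 + Real.pi ^ 2 ≠ 0 := by positivity
      have h2 : (1 + ((x - u) / Real.pi) ^ 2) ≠ 0 := by positivity
      field_simp
      ring
    rw [e]
    constructor
    · exact ((integrable_inv_one_add_sq.comp_div hπ.ne').comp_sub_right u).const_mul _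
    · rw [integral_const_mul,
        integral_sub_right_eq_self (fun x : ℝ => (1 + (x / Real.pi) ^ 2)⁻¹) u,
        Measure.integral_comp_div (fun x : ℝ => (1 + x ^ 2)⁻¹), integral_univ_inv_one_add_sq,
        abs_of_pos hπ, smul_eq_mul, inv_mul_cancel_left₀ hπ.ne']
  have hKc : Continuous K := by
    refine Continuous.div (by fun_prop) (by fun_prop) fun x => ?_
    positivity
  have hPlim := intervalIntegral_tendsto_integral hP.1 tendsto_neg_atTop_atBot tendsto_id
  rw [hP.2] at hPlim
  have hKlim : Tendsto (fun R : ℝ => ∫ x in -R..R, K x) atTop (𝓝 (-1 - r)) := by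
    have := (hmain.sub (hPlim.const_mul r)).const_mul Real.pi⁻¹
    have e : Real.pi⁻¹ * (Real.pi * ((-1 : ℂ).re - (0 : ℂ).re) - r * Real.pi) = -1 - r := by
      simp
      field_simp
    rw [e] at this
    refine this.congr fun R => ?_
    simp only [id]
    rw [intervalIntegral.integral_congr (fun x _ => himg x), intervalIntegral.integral_add
      ((hKc.intervalIntegrable _ _).const_mul _) (hP.1.intervalIntegrable.const_mul _),
      intervalIntegral.integral_const_mul, intervalIntegral.integral_const_mul]
    field_simp
    ring
  have hKn : ∀ x, ‖K x‖ = K x := fun x => Real.norm_of_nonneg (by positivity)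
  have hKi : Integrable K := by
    refine integrable_of_intervalIntegral_norm_tendsto (-1 - r)
      (fun R : ℝ => (hKc.integrableOn_Icc (a := -R) (b := R)).mono_set Set.Ioc_subset_Icc_self)
      tendsto_neg_atTop_atBot tendsto_id ?_
    simpa only [hKn] using hKlim
  refine ⟨hKi, ?_⟩
  rw [tendsto_nhds_unique (intervalIntegral_tendsto_integral hKi tendsto_neg_atTop_atBot tendsto_id)
    hKlim, hr]
  ring


/-- The logistic-type substitution `s = 1 / (1 + exp x)` from `ℝ` onto `(0, 1)`. -/
noncomputable def sig (x : ℝ) : ℝ := (1 + Real.exp x)⁻¹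

/-- The density of `tau0 (1 - s) ds` in the variable `x` with `s = sig x`. -/
noncomputable def tauDensity (x : ℝ) : ℝ :=
  (1 + Real.exp x) / ((x + 1 + Real.exp x) ^ 2 + Real.pi ^ 2)

theorem sig_pos (x : ℝ) : 0 < sig x := by
  have := Real.exp_pos x
  unfold sig
  positivity

theorem sig_lt_one (x : ℝ) : sig x < 1 :=
  inv_lt_one_of_one_lt₀ (by linarith [Real.exp_pos x])

theorem tauDensity_pos (x : ℝ) : 0 < tauDensity x := by
  unfold tauDensity
  positivity

theorem continuous_sig : Continuous sig :=
  Continuous.inv₀ (by fun_prop) fun x => by positivity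

theorem continuous_tauDensity : Continuous tauDensity :=
  Continuous.div (by fun_prop) (by fun_prop) fun x => by positivity

theorem hasDerivAt_sig (x : ℝ) : HasDerivAt sig (-Real.exp x / (1 + Real.exp x) ^ 2) x :=
  ((Real.hasDerivAt_exp x).const_add 1).inv (by positivity)

theorem injective_sig : Function.Injective sig := by
  intro x y h
  have := inv_injective h
  exact Real.exp_injective (add_left_cancel this)

theorem range_sig : sig '' Set.univ = Set.Ioo 0 1 := by
  ext s
  simp only [Set.image_univ, Set.mem_range, Set.mem_Ioo]
  constructor
  · rintro ⟨x, rfl⟩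
    exact ⟨sig_pos x, sig_lt_one x⟩
  · rintro ⟨h0, h1⟩
    refine ⟨Real.log (s⁻¹ - 1), ?_⟩
    have : 1 < s⁻¹ := (one_lt_inv₀ h0).2 h1
    rw [sig, Real.exp_log (by linarith)]
    simp

theorem abs_deriv_sig_mul_tau0 (x : ℝ) :
    |-Real.exp x / (1 + Real.exp x) ^ 2| * tau0 (1 - sig x) = tauDensity x := by
  have he := Real.exp_pos x
  have h1 : 1 - sig x = Real.exp x / (1 + Real.exp x) := by
    unfold sig
    field_simp
    ring
  have h2 : (1 - (1 - sig x)) / (1 - sig x) = Real.exp (-x) := by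
    rw [h1, Real.exp_neg]
    field_simp
    ring
  rw [neg_div, abs_neg, abs_of_pos (by positivity), tau0, h2, Real.log_exp, h1, tauDensity]
  have h3 : 1 - Real.exp x / (1 + Real.exp x) = (1 + Real.exp x)⁻¹ := by
    field_simp
    ring
  rw [h3]
  have h4 : Real.exp x / (1 + Real.exp x) * ((1 + Real.exp x)⁻¹ * -x - 1) ^ 2 +
      Real.pi ^ 2 * (Real.exp x / (1 + Real.exp x)) * (1 + Real.exp x)⁻¹ ^ 2 =
      Real.exp x * ((x + 1 + Real.exp x) ^ 2 + Real.pi ^ 2) / (1 + Real.exp x) ^ 3 := by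
    field_simp
    ring
  rw [h4]
  field_simp

theorem tmom_eq (n : ℕ) : tmom n = ∫ x, sig x ^ n * tauDensity x := by
  rw [tmom, intervalIntegral.integral_of_le zero_le_one, integral_Ioc_eq_integral_Ioo, ← range_sig,
    integral_image_eq_integral_abs_deriv_smul MeasurableSet.univ
      (fun x _ => (hasDerivAt_sig x).hasDerivWithinAt) injective_sig.injOn, setIntegral_univ]
  congr 1
  ext x
  rw [← abs_deriv_sig_mul_tau0, smul_eq_mul]
  ring

theorem kernel_eq (y x : ℝ) (hy : y < 1) : (1 + Real.exp x) ^ 2 /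
    ((Real.exp (Real.log (1 - y)) + Real.exp x) * ((x + 1 + Real.exp x) ^ 2 + Real.pi ^ 2)) =
    (1 - y * sig x)⁻¹ * tauDensity x := by
  have he := Real.exp_pos x
  rw [Real.exp_log (by linarith), tauDensity]
  have h1 : 1 - y * sig x = (1 - y + Real.exp x) / (1 + Real.exp x) := by
    unfold sig
    field_simp
    ring
  have h2 : 0 < 1 - y + Real.exp x := by linarith
  rw [h1]
  field_simp

theorem integrable_tauDensity : Integrable tauDensity := by
  have h := (integrable_and_integral_kernel
    (u := Real.log (1 - 1 / 2)) (Real.log_neg (by norm_num) (by norm_num))).1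
  refine h.mono' continuous_tauDensity.aestronglyMeasurable (Eventually.of_forall fun x => ?_)
  rw [Real.norm_of_nonneg (tauDensity_pos x).le, kernel_eq _ _ (by norm_num)]
  refine le_mul_of_one_le_left (tauDensity_pos x).le ((one_le_inv₀ ?_).2 ?_) <;>
    linarith [sig_pos x, sig_lt_one x]

theorem integrable_sig_pow_mul (n : ℕ) : Integrable fun x => sig x ^ n * tauDensity x := by
  refine integrable_tauDensity.mono'
    ((continuous_sig.pow n).mul continuous_tauDensity).aestronglyMeasurable
    (Eventually.of_forall fun x => ?_)
  rw [Real.norm_of_nonneg (mul_nonneg (pow_nonneg (sig_pos x).le n) (tauDensity_pos x).le)]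
  exact mul_le_of_le_one_left (tauDensity_pos x).le (pow_le_one₀ (sig_pos x).le (sig_lt_one x).le)

theorem tmom_nonneg (n : ℕ) : 0 ≤ tmom n := by
  rw [tmom_eq]
  exact integral_nonneg fun x => mul_nonneg (pow_nonneg (sig_pos x).le n) (tauDensity_pos x).le

theorem antitone_tmom : Antitone tmom := by
  intro m n h
  rw [tmom_eq, tmom_eq]
  refine integral_mono (integrable_sig_pow_mul n) (integrable_sig_pow_mul m) fun x => ?_
  exact mul_le_mul_of_nonneg_right (pow_le_pow_of_le_one (sig_pos x).le (sig_lt_one x).le h)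
    (tauDensity_pos x).le

theorem hasSum_tmom_mul_pow {y : ℝ} (hy0 : 0 < y) (hy1 : y < 1) :
    HasSum (fun n => tmom n * y ^ n) (y ^ 2 / ((1 - y) * (-Real.log (1 - y) - y)) - 1) := by
  have hk := (integrable_and_integral_kernel
    (u := Real.log (1 - y)) (Real.log_neg (by linarith) (by linarith))).2
  simp_rw [kernel_eq y _ hy1] at hk
  rw [Real.exp_log (by linarith)] at hk
  have e : (1 - (1 - y)) ^ 2 / ((1 - y) * (1 - y - 1 - Real.log (1 - y))) - 1 =
      y ^ 2 / ((1 - y) * (-Real.log (1 - y) - y)) - 1 := by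
    congr 2 <;> ring
  rw [e] at hk
  have hi : ∀ n : ℕ, ∫ x, y ^ n * (sig x ^ n * tauDensity x) = tmom n * y ^ n := fun n => by
    rw [integral_const_mul, ← tmom_eq, mul_comm]
  have hnn : ∀ (n : ℕ) x, ‖y ^ n * (sig x ^ n * tauDensity x)‖ =
      y ^ n * (sig x ^ n * tauDensity x) := fun n x =>
    Real.norm_of_nonneg (mul_nonneg (pow_nonneg hy0.le n)
      (mul_nonneg (pow_nonneg (sig_pos x).le n) (tauDensity_pos x).le))
  have hs := hasSum_integral_of_summable_integral_norm (μ := volume)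
    (F := fun (n : ℕ) x => y ^ n * (sig x ^ n * tauDensity x))
    (fun n => (integrable_sig_pow_mul n).const_mul _) (by
      simp_rw [hnn, hi]
      refine Summable.of_nonneg_of_le (fun n => mul_nonneg (tmom_nonneg n) (pow_nonneg hy0.le n))
        (fun n => mul_le_mul_of_nonneg_right (antitone_tmom (Nat.zero_le n)) (pow_nonneg hy0.le n))
        ((summable_geometric_of_lt_one hy0.le hy1).mul_left _))
  simp_rw [hi] at hs
  have ht : ∀ x, ∑' n : ℕ, y ^ n * (sig x ^ n * tauDensity x) =
      (1 - y * sig x)⁻¹ * tauDensity x := fun x => by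
    rw [← tsum_geometric_of_lt_one (mul_nonneg hy0.le (sig_pos x).le)
      (by nlinarith [sig_lt_one x, sig_pos x]), ← tsum_mul_right]
    exact tsum_congr fun n => by rw [mul_pow, mul_assoc]
  simp_rw [ht] at hs
  rwa [hk] at hs

theorem eq_zero_of_hasSum_mul_pow_zero {d : ℕ → ℝ}
    (h : ∀ y : ℝ, 0 < y → y < 1 → HasSum (fun n => d n * y ^ n) 0) (n : ℕ) : d n = 0 := by
  set p := FormalMultilinearSeries.ofScalars ℝ d with hp
  have hr : ((1 / 2 : NNReal) : ENNReal) ≤ p.radius := by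
    have hs := (h (1 / 2) (by norm_num) (by norm_num)).summable.tendsto_atTop_zero
    refine p.le_radius_of_tendsto (l := 0) ?_
    have := hs.norm
    rw [norm_zero] at this
    refine this.congr fun n => ?_
    simp [hp]
  have hb := p.hasFPowerSeriesOnBall (lt_of_lt_of_le (by simp) hr)
  have hz : ∀ᶠ z in 𝓝 (0 : ℝ), p.sum z = (fun _ => (0 : ℝ)) z := by
    refine (hb.analyticAt.frequently_eq_iff_eventually_eq analyticAt_const).1 ?_
    have hev : ∀ᶠ z in 𝓝[>] (0 : ℝ), p.sum z = 0 := by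
      filter_upwards [Ioo_mem_nhdsGT (zero_lt_one' ℝ)] with z hz
      have := (h z hz.1 hz.2).tsum_eq
      simpa [FormalMultilinearSeries.sum, hp, FormalMultilinearSeries.ofScalars_apply_eq, mul_comm]
        using this
    exact hev.frequently.filter_mono (nhdsWithin_mono 0 fun z hz => ne_of_gt hz)
  have h0 : p = 0 := HasFPowerSeriesAt.eq_zero (hb.hasFPowerSeriesAt.congr hz)
  rw [← FormalMultilinearSeries.coeff_ofScalars (𝕜 := ℝ) (p := d) (n := n), ← hp, h0]
  rfl

/-- Coefficients of `1 + ∑ tmom n * y ^ n`. -/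
noncomputable def renewalCoeff (n : ℕ) : ℝ := tmom n + if n = 0 then 1 else 0

theorem hasSum_renewalCoeff_mul_pow {y : ℝ} (hy0 : 0 < y) (hy1 : y < 1) :
    HasSum (fun n => renewalCoeff n * y ^ n) (y ^ 2 / ((1 - y) * (-Real.log (1 - y) - y))) := by
  have h1 : HasSum (fun n : ℕ => (if n = 0 then (1 : ℝ) else 0) * y ^ n) 1 := by
    have := hasSum_ite_eq (0 : ℕ) (1 : ℝ)
    refine this.congr_fun fun n => ?_
    by_cases h : n = 0 <;> simp [h]
  have := (hasSum_tmom_mul_pow hy0 hy1).add h1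
  rw [sub_add_cancel] at this
  simpa only [renewalCoeff, add_mul] using this

theorem hasSum_log_remainder {y : ℝ} (hy0 : 0 < y) (hy1 : y < 1) :
    HasSum (fun n : ℕ => y ^ (n + 2) / ((n : ℝ) + 2)) (-Real.log (1 - y) - y) := by
  have h := Real.hasSum_pow_div_log_of_abs_lt_one (x := y) (by rw [abs_of_pos hy0]; exact hy1)
  rw [← hasSum_nat_add_iff' 1] at h
  simp at h
  refine h.congr_fun fun n => ?_
  ring

theorem log_remainder_pos {y : ℝ} (hy0 : 0 < y) (hy1 : y < 1) : 0 < -Real.log (1 - y) - y := by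
  have := Real.log_lt_sub_one_of_pos (x := 1 - y) (by linarith) (by linarith)
  linarith

theorem sum_renewalCoeff_div (n : ℕ) :
    ∑ k ∈ Finset.range (n + 1), renewalCoeff k * (((n - k : ℕ) : ℝ) + 2)⁻¹ = 1 := by
  rw [← sub_eq_zero]
  refine eq_zero_of_hasSum_mul_pow_zero (d := fun n => ∑ k ∈ Finset.range (n + 1),
    renewalCoeff k * (((n - k : ℕ) : ℝ) + 2)⁻¹ - 1) (fun y hy0 hy1 => ?_) n
  have ha := hasSum_renewalCoeff_mul_pow hy0 hy1
  have hl := log_remainder_pos hy0 hy1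
  have hb : HasSum (fun n : ℕ => ((n : ℝ) + 2)⁻¹ * y ^ n) ((-Real.log (1 - y) - y) / y ^ 2) := by
    refine ((hasSum_log_remainder hy0 hy1).div_const (y ^ 2)).congr_fun fun n => ?_
    field_simp
    ring
  have hpos : ∀ n, 0 ≤ renewalCoeff n := fun n => by
    have := tmom_nonneg n
    unfold renewalCoeff
    split_ifs <;> linarith
  have ha' : Summable fun n => ‖renewalCoeff n * y ^ n‖ := ha.summable.norm
  have hb' : Summable fun n : ℕ => ‖((n : ℝ) + 2)⁻¹ * y ^ n‖ := hb.summable.norm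
  have hc := (summable_norm_sum_mul_range_of_summable_norm ha' hb').of_norm.hasSum
  rw [← tsum_mul_tsum_eq_tsum_sum_range_of_summable_norm ha' hb', ha.tsum_eq, hb.tsum_eq] at hc
  have hg := hasSum_geometric_of_lt_one hy0.le hy1
  have hd := hc.sub hg
  have hy1' : 1 - y ≠ 0 := by linarith
  have e : y ^ 2 / ((1 - y) * (-Real.log (1 - y) - y)) * ((-Real.log (1 - y) - y) / y ^ 2) -
      (1 - y)⁻¹ = 0 := by
    field_simp
    ring
  rw [e] at hd
  refine hd.congr_fun fun n => ?_
  rw [sub_mul, one_mul, Finset.sum_mul]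
  congr 1
  refine Finset.sum_congr rfl fun k hk => ?_
  have : k + (n - k) = n := by
    have := Finset.mem_range.1 hk
    omega
  nth_rewrite 2 [← this]
  rw [pow_add]
  ring


theorem tmom_zero : tmom 0 = 1 := by
  have h := sum_renewalCoeff_div 0
  simp [renewalCoeff] at h
  linarith

theorem tmom_succ_ge (n : ℕ) :
    tmom n * (1 - 2 / ((n : ℝ) + 2)) + 4 / (((n : ℝ) + 2) * ((n : ℝ) + 3)) ≤ tmom (n + 1) := by
  have h0 := sum_renewalCoeff_div n
  have h1 := sum_renewalCoeff_div (n + 1)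
  rw [Finset.sum_range_succ'] at h0
  rw [Finset.sum_range_succ, Finset.sum_range_succ'] at h1
  have htel : ∑ k ∈ Finset.range n, ((((n - (k + 1) : ℕ) : ℝ) + 2)⁻¹ -
      (((n + 1 - (k + 1) : ℕ) : ℝ) + 2)⁻¹) = 1 / 2 - 1 / ((n : ℝ) + 2) := by
    have e : ∀ k ∈ Finset.range n, ((((n - (k + 1) : ℕ) : ℝ) + 2)⁻¹ -
        (((n + 1 - (k + 1) : ℕ) : ℝ) + 2)⁻¹) =
        (((n - 1 - k : ℕ) : ℝ) + 2)⁻¹ - (((n - 1 - k + 1 : ℕ) : ℝ) + 2)⁻¹ := fun k hk => by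
      have := Finset.mem_range.1 hk
      rw [show n - (k + 1) = n - 1 - k by omega, show n + 1 - (k + 1) = n - 1 - k + 1 by omega]
    rw [Finset.sum_congr rfl e, Finset.sum_range_reflect
      (fun j => ((j : ℝ) + 2)⁻¹ - (((j + 1 : ℕ) : ℝ) + 2)⁻¹),
      Finset.sum_range_sub' (fun j => ((j : ℝ) + 2)⁻¹)]
    simp
  have hge : tmom n * ∑ k ∈ Finset.range n, ((((n - (k + 1) : ℕ) : ℝ) + 2)⁻¹ -
      (((n + 1 - (k + 1) : ℕ) : ℝ) + 2)⁻¹) ≤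
      ∑ k ∈ Finset.range n, renewalCoeff (k + 1) * (((n - (k + 1) : ℕ) : ℝ) + 2)⁻¹ -
      ∑ k ∈ Finset.range n, renewalCoeff (k + 1) * (((n + 1 - (k + 1) : ℕ) : ℝ) + 2)⁻¹ := by
    rw [← Finset.sum_sub_distrib, Finset.mul_sum]
    refine Finset.sum_le_sum fun k hk => ?_
    have hk' := Finset.mem_range.1 hk
    rw [← mul_sub]
    refine mul_le_mul_of_nonneg_right ?_ ?_
    · simpa [renewalCoeff] using antitone_tmom (Nat.succ_le_of_lt hk')
    · rw [sub_nonneg]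
      refine inv_anti₀ (by positivity) ?_
      gcongr
      omega
  rw [htel] at hge
  simp only [renewalCoeff, tmom_zero, if_true, Nat.sub_zero, Nat.sub_self] at h0 h1
  simp only [Nat.add_eq_zero_iff, one_ne_zero, and_false, if_false, add_zero] at h0 h1
  simp only [renewalCoeff, Nat.add_eq_zero_iff, one_ne_zero, and_false, if_false, add_zero,
    Nat.add_sub_add_right] at hge
  push_cast at h0 h1
  have hn : (0 : ℝ) ≤ n := Nat.cast_nonneg n
  have e : 2 * ((1 + 1) * ((n : ℝ) + 2)⁻¹ - (1 + 1) * ((n : ℝ) + 1 + 2)⁻¹) =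
      4 / (((n : ℝ) + 2) * ((n : ℝ) + 3)) := by
    field_simp
    ring
  have e2 : tmom n * (1 - 2 / ((n : ℝ) + 2)) = 2 * (tmom n * (1 / 2 - 1 / ((n : ℝ) + 2))) := by
    ring
  rw [e2, ← e]
  linarith

theorem tmom_one : tmom 1 = 2 / 3 := by
  have h := sum_renewalCoeff_div 1
  simp [Finset.sum_range_succ, renewalCoeff, tmom_zero] at h
  norm_num at h
  linarith

theorem tmom_two : tmom 2 = 5 / 9 := by
  have h := sum_renewalCoeff_div 2
  simp [Finset.sum_range_succ, renewalCoeff, tmom_zero, tmom_one] at h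
  norm_num at h
  linarith

theorem tmom_three : tmom 3 = 67 / 135 := by
  have h := sum_renewalCoeff_div 3
  simp [Finset.sum_range_succ, renewalCoeff, tmom_zero, tmom_one, tmom_two] at h
  norm_num at h
  linarith

theorem tmom_four_ge : 9 / 20 ≤ tmom 4 := by
  have h := sum_renewalCoeff_div 4
  simp [Finset.sum_range_succ, renewalCoeff, tmom_zero, tmom_one, tmom_two, tmom_three] at h
  norm_num at h
  linarith

theorem two_div_le_tmom {n : ℕ} (hn : 4 ≤ n) : 2 / ((n : ℝ) + 1) ≤ tmom n := by
  induction n, hn using Nat.le_induction with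
  | base => have := tmom_four_ge; norm_num; linarith
  | succ n hn ih =>
    refine le_trans ?_ (tmom_succ_ge n)
    have hn' : (4 : ℝ) ≤ n := by exact_mod_cast hn
    have h1 : 0 ≤ 1 - 2 / ((n : ℝ) + 2) := by
      rw [sub_nonneg, div_le_one (by linarith)]
      linarith
    refine le_trans ?_ (add_le_add_left (mul_le_mul_of_nonneg_right ih h1) _)
    push_cast
    have e : 2 / ((n : ℝ) + 1) * (1 - 2 / ((n : ℝ) + 2)) + 4 / (((n : ℝ) + 2) * ((n : ℝ) + 3)) -
        2 / ((n : ℝ) + 1 + 1) = 2 * ((n : ℝ) - 1) / ((n + 1) * (n + 2) * (n + 3)) := by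
      field_simp
      ring
    have : 0 ≤ 2 * ((n : ℝ) - 1) / ((n + 1) * (n + 2) * (n + 3)) := by
      apply div_nonneg
      · linarith
      · positivity
    linarith

/-- The coefficients of the exponential series `Gfun 2`. -/
noncomputable def gCoeff (n : ℕ) : ℝ := if n = 0 then 2 else tmom n - 2 / ((n : ℝ) + 1)

theorem abs_gCoeff_le (n : ℕ) : |gCoeff n| ≤ 2 := by
  unfold gCoeff
  split_ifs with h
  · norm_num
  · have h0 := tmom_nonneg n
    have h1 := antitone_tmom (Nat.zero_le n)
    rw [tmom_zero] at h1
    have h2 : 0 ≤ 2 / ((n : ℝ) + 1) := by positivity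
    have h3 : 2 / ((n : ℝ) + 1) ≤ 2 := div_le_self (by norm_num) (by simp)
    rw [abs_le]
    constructor <;> linarith

theorem summable_gCoeff (x : ℝ) : Summable fun n : ℕ => gCoeff n * (x ^ n / n.factorial) := by
  have h := (Real.summable_pow_div_factorial |x|).mul_left 2
  refine Summable.of_norm_bounded h fun n => ?_
  rw [norm_mul, Real.norm_eq_abs, norm_div, norm_pow, Real.norm_eq_abs, Real.norm_natCast]
  exact mul_le_mul_of_nonneg_right (abs_gCoeff_le n) (by positivity)

theorem hasSum_Gfun_two (x : ℝ) :
    HasSum (fun n : ℕ => gCoeff n * (x ^ n / n.factorial)) (Gfun 2 x) := by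
  have h := (summable_gCoeff x).hasSum
  rw [(summable_gCoeff x).tsum_eq_zero_add] at h
  convert h using 1
  rw [Gfun]
  congr 1
  · simp [gCoeff]
  · refine tsum_congr fun n => ?_
    simp only [gCoeff, Nat.add_eq_zero_iff, one_ne_zero, and_false, if_false]
    push_cast
    rw [mul_comm, add_assoc]
    norm_num

theorem Gfun_two_pos {x : ℝ} (hx : 0 < x) : 0 < Gfun 2 x := by
  have h := sum_le_hasSum (Finset.range 5) (fun n hn => ?_) (hasSum_Gfun_two x)
  · refine lt_of_lt_of_le ?_ h
    simp only [Finset.sum_range_succ, Finset.sum_range_zero, gCoeff, tmom_one, tmom_two, tmom_three]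
    have h4 := mul_le_mul_of_nonneg_right tmom_four_ge (pow_nonneg hx.le 4)
    norm_num [Nat.factorial]
    nlinarith [sq_nonneg (x ^ 2 - 21), sq_nonneg (x - 9 / 2), sq_nonneg (x * (x - 9 / 2)),
      sq_nonneg (x ^ 2 - 9 / 2 * x), pow_pos hx 3, pow_pos hx 2]
  · have hn' : 5 ≤ n := by simpa using hn
    have h2 := two_div_le_tmom (show 4 ≤ n by omega)
    refine mul_nonneg ?_ (by positivity)
    rw [gCoeff, if_neg (by omega)]
    linarith


theorem measurable_Gfun_two : Measurable (Gfun 2) := by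
  refine measurable_of_tendsto_metrizable
    (f := fun (N : ℕ) x => ∑ n ∈ Finset.range N, gCoeff n * (x ^ n / n.factorial))
    (fun N => ?_) (tendsto_pi_nhds.2 fun x => (hasSum_Gfun_two x).tendsto_sum_nat)
  fun_prop

theorem abs_Gfun_two_le {x : ℝ} (hx : 0 ≤ x) : |Gfun 2 x| ≤ 2 * Real.exp x := by
  have he : HasSum (fun n : ℕ => x ^ n / n.factorial) (Real.exp x) := by
    rw [Real.exp_eq_exp_ℝ]
    exact NormedSpace.expSeries_div_hasSum_exp x
  rw [← (hasSum_Gfun_two x).tsum_eq, ← Real.norm_eq_abs]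
  refine tsum_of_norm_bounded (he.mul_left 2) fun n => ?_
  rw [norm_mul, Real.norm_eq_abs, Real.norm_of_nonneg (by positivity)]
  exact mul_le_mul_of_nonneg_right (abs_gCoeff_le n) (by positivity)

theorem integral_pow_mul_exp_neg_mul_Ioi {w : ℝ} (hw : 0 < w) (n : ℕ) :
    ∫ u in Set.Ioi (0 : ℝ), u ^ n * Real.exp (-(w * u)) = n.factorial * w⁻¹ ^ (n + 1) := by
  have h := Real.integral_rpow_mul_exp_neg_mul_Ioi (a := (n : ℝ) + 1) (by positivity) hw
  rw [Real.Gamma_nat_eq_factorial] at h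
  simp only [add_sub_cancel_right, Real.rpow_natCast] at h
  rw [h, mul_comm, one_div]
  norm_cast

theorem integrableOn_pow_mul_exp_neg_mul {w : ℝ} (hw : 0 < w) (n : ℕ) :
    IntegrableOn (fun u => u ^ n * Real.exp (-(w * u))) (Set.Ioi (0 : ℝ)) := by
  refine Integrable.of_integral_ne_zero ?_
  rw [integral_pow_mul_exp_neg_mul_Ioi hw]
  positivity

theorem integrableOn_exp_mul_Gfun_two {x : ℝ} (hx : 0 < x) :
    IntegrableOn (fun u => Real.exp (-u) * Gfun 2 u * Real.exp (x * -u)) (Set.Ioi (0 : ℝ)) := by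
  have h := (integrableOn_pow_mul_exp_neg_mul hx 0).const_mul 2
  refine Integrable.mono' h (by
    have := measurable_Gfun_two
    exact Measurable.aestronglyMeasurable (by fun_prop)) ?_
  filter_upwards [ae_restrict_mem measurableSet_Ioi] with u hu
  have hu0 : 0 ≤ u := le_of_lt hu
  rw [norm_mul, norm_mul, Real.norm_eq_abs, Real.norm_eq_abs, Real.norm_eq_abs, Real.abs_exp,
    Real.abs_exp]
  calc Real.exp (-u) * |Gfun 2 u| * Real.exp (x * -u)
      ≤ Real.exp (-u) * (2 * Real.exp u) * Real.exp (x * -u) := by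
        gcongr
        exact abs_Gfun_two_le hu0
    _ = 2 * (u ^ 0 * Real.exp (-(x * u))) * (Real.exp (-u) * Real.exp u) := by
        rw [mul_neg]
        ring
    _ = _ := by
        rw [← Real.exp_add]
        simp

theorem hasSum_laplace_Gfun_two {x : ℝ} (hx : 0 < x) :
    HasSum (fun n : ℕ => gCoeff n * (x + 1)⁻¹ ^ (n + 1))
      (∫ u in Set.Ioi (0 : ℝ), Real.exp (-u) * Gfun 2 u * Real.exp (x * -u)) := by
  have hw : 0 < x + 1 := by linarith
  have hf : ∀ n : ℕ, (n.factorial : ℝ) ≠ 0 := fun n => by positivity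
  have h := hasSum_integral_of_summable_integral_norm
    (μ := volume.restrict (Set.Ioi (0 : ℝ)))
    (F := fun (n : ℕ) u => gCoeff n / n.factorial * (u ^ n * Real.exp (-((x + 1) * u))))
    (fun n => (integrableOn_pow_mul_exp_neg_mul hw n).const_mul _) (by
      have hn : ∀ n : ℕ, ∫ u in Set.Ioi (0 : ℝ),
          ‖gCoeff n / n.factorial * (u ^ n * Real.exp (-((x + 1) * u)))‖ =
          |gCoeff n| * (x + 1)⁻¹ ^ (n + 1) := fun n => by
        have : ∀ u ∈ Set.Ioi (0 : ℝ),
            ‖gCoeff n / n.factorial * (u ^ n * Real.exp (-((x + 1) * u)))‖ =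
            |gCoeff n| / n.factorial * (u ^ n * Real.exp (-((x + 1) * u))) := fun u hu => by
          have hu0 : 0 < u := hu
          rw [norm_mul, norm_div, Real.norm_eq_abs, Real.norm_natCast,
            Real.norm_of_nonneg (by positivity)]
        rw [setIntegral_congr_fun measurableSet_Ioi this, integral_const_mul,
          integral_pow_mul_exp_neg_mul_Ioi hw]
        have := hf n
        field_simp
      simp_rw [hn]
      have hg : Summable fun n : ℕ => 2 * (x + 1)⁻¹ ^ (n + 1) := by
        refine Summable.mul_left _ ((summable_nat_add_iff 1).2 ?_)
        exact summable_geometric_of_lt_one (by positivity) (inv_lt_one_of_one_lt₀ (by linarith))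
      exact Summable.of_nonneg_of_le (fun n => by positivity)
        (fun n => mul_le_mul_of_nonneg_right (abs_gCoeff_le n) (by positivity)) hg)
  have h1 : ∀ n : ℕ, ∫ u in Set.Ioi (0 : ℝ),
      gCoeff n / n.factorial * (u ^ n * Real.exp (-((x + 1) * u))) =
      gCoeff n * (x + 1)⁻¹ ^ (n + 1) := fun n => by
    rw [integral_const_mul, integral_pow_mul_exp_neg_mul_Ioi hw]
    have := hf n
    field_simp
  have h2 : ∀ u : ℝ, ∑' n : ℕ, gCoeff n / n.factorial * (u ^ n * Real.exp (-((x + 1) * u))) =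
      Real.exp (-u) * Gfun 2 u * Real.exp (x * -u) := fun u => by
    have e : Real.exp (-((x + 1) * u)) = Real.exp (-u) * Real.exp (x * -u) := by
      rw [← Real.exp_add]
      ring_nf
    rw [mul_right_comm, ← e, ← (hasSum_Gfun_two u).tsum_eq, ← tsum_mul_left]
    exact tsum_congr fun n => by ring
  simp_rw [h1, h2] at h
  exact h

theorem hasDerivAt_mul_log_one_add_inv {x : ℝ} (hx : 0 < x) :
    HasDerivAt (fun x : ℝ => 2 * x * Real.log (1 + 1 / x))
      (2 * (Real.log (1 + 1 / x) - (x + 1)⁻¹)) x := by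
  have h0 : HasDerivAt (fun x : ℝ => 1 + 1 / x) (-(x ^ 2)⁻¹) x := by
    simpa [one_div] using (hasDerivAt_inv hx.ne').const_add 1
  have h1 := ((hasDerivAt_id x).const_mul 2).mul (h0.log (by positivity))
  refine h1.congr_deriv ?_
  simp only [id]
  field_simp
  ring

theorem hasDerivAt_log_one_add_inv_sub {x : ℝ} (hx : 0 < x) :
    HasDerivAt (fun x : ℝ => 2 * (Real.log (1 + 1 / x) - (x + 1)⁻¹))
      (-2 / (x * (x + 1) ^ 2)) x := by
  have h0 : HasDerivAt (fun x : ℝ => 1 + 1 / x) (-(x ^ 2)⁻¹) x := by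
    simpa [one_div] using (hasDerivAt_inv hx.ne').const_add 1
  have h1 : HasDerivAt (fun x : ℝ => (x + 1)⁻¹) (-1 / (x + 1) ^ 2) x :=
    ((hasDerivAt_id x).add_const 1).inv (by simp; positivity)
  refine (((h0.log (by positivity)).sub h1).const_mul 2).congr_deriv ?_
  field_simp
  ring

theorem neg_deriv_deriv_hfun_div {x : ℝ} (hx : 0 < x)
    (hpos : 0 < Real.log (1 + 1 / x) - (x + 1)⁻¹) :
    -deriv (deriv (hfun 2)) x / deriv (hfun 2) x =
      1 / (x * (x + 1) ^ 2 * (Real.log (1 + 1 / x) - (x + 1)⁻¹)) -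
        2 * (Real.log (1 + 1 / x) - (x + 1)⁻¹) := by
  have h1 : ∀ z : ℝ, 0 < z → HasDerivAt (hfun 2)
      (hfun 2 z * (2 * (Real.log (1 + 1 / z) - (z + 1)⁻¹))) z :=
    fun z hz => (hasDerivAt_mul_log_one_add_inv hz).exp
  have h2 : deriv (hfun 2) =ᶠ[𝓝 x]
      fun z => hfun 2 z * (2 * (Real.log (1 + 1 / z) - (z + 1)⁻¹)) := by
    filter_upwards [lt_mem_nhds hx] with z hz using (h1 z hz).deriv
  have h3 : deriv (fun z => hfun 2 z * (2 * (Real.log (1 + 1 / z) - (z + 1)⁻¹))) x = _ :=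
    ((h1 x hx).mul (hasDerivAt_log_one_add_inv_sub hx)).deriv
  rw [h2.deriv_eq, h3, (h1 x hx).deriv]
  have hh : hfun 2 x ≠ 0 := (Real.exp_pos _).ne'
  set p := Real.log (1 + 1 / x) - (x + 1)⁻¹
  have hp := hpos.ne'
  field_simp
  ring

theorem neg_deriv_deriv_hfun_div_eq_integral {x : ℝ} (hx : 0 < x) :
    -deriv (deriv (hfun 2)) x / deriv (hfun 2) x =
      ∫ u in Set.Ioi (0 : ℝ), Real.exp (-u) * Gfun 2 u * Real.exp (x * -u) := by
  set y := (x + 1)⁻¹ with hy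
  have hy0 : 0 < y := by positivity
  have hy1 : y < 1 := inv_lt_one_of_one_lt₀ (by linarith)
  have hc : 1 - y = x * y := by
    rw [hy]
    field_simp
    ring
  have hlog : -Real.log (1 - y) = Real.log (1 + 1 / x) := by
    rw [← Real.log_inv, hc, hy]
    congr 1
    field_simp
  have hpos := log_remainder_pos hy0 hy1
  have ha := (hasSum_renewalCoeff_mul_pow hy0 hy1).mul_right y
  have hl := hasSum_log_remainder hy0 hy1
  rw [hlog] at hpos ha hl
  rw [neg_deriv_deriv_hfun_div hx hpos, ← hy]
  have hl0 : HasSum (fun n : ℕ => if n = 0 then 0 else y ^ (n + 1) / ((n : ℝ) + 1))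
      (Real.log (1 + 1 / x) - y) := by
    rw [← hasSum_nat_add_iff' 1]
    simp only [Finset.sum_range_one, if_true, sub_zero, Nat.add_eq_zero_iff, one_ne_zero,
      and_false, if_false]
    refine hl.congr_fun fun n => ?_
    push_cast
    ring
  have hs := ha.sub (hl0.mul_left 2)
  have e : (fun n : ℕ => renewalCoeff n * y ^ n * y -
      2 * if n = 0 then 0 else y ^ (n + 1) / ((n : ℝ) + 1)) =
      fun n => gCoeff n * y ^ (n + 1) := by
    ext n
    by_cases h : n = 0
    · simp [h, renewalCoeff, gCoeff, tmom_zero]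
      norm_num
    · simp only [h, renewalCoeff, gCoeff, if_false]
      ring
  rw [e] at hs
  rw [← hs.unique (hasSum_laplace_Gfun_two hx), hc]
  congr 1
  have hxy : x + 1 = y⁻¹ := by rw [hy, inv_inv]
  rw [hxy]
  set p := Real.log (1 + 1 / x) - y
  have hp := hpos.ne'
  field_simp

/-- The measure whose Laplace transform is `-h₂″ / h₂′`. -/
noncomputable def hMeasure : Measure ℝ :=
  (volume.restrict (Set.Ioi 0)).withDensity fun u => ENNReal.ofReal (Real.exp (-u) * Gfun 2 u)

theorem measurable_hMeasure_density :
    Measurable fun u => ENNReal.ofReal (Real.exp (-u) * Gfun 2 u) := by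
  have := measurable_Gfun_two
  fun_prop

theorem toReal_hMeasure_density {u : ℝ} (hu : 0 < u) :
    (ENNReal.ofReal (Real.exp (-u) * Gfun 2 u)).toReal = Real.exp (-u) * Gfun 2 u :=
  ENNReal.toReal_ofReal (mul_nonneg (Real.exp_pos _).le (Gfun_two_pos hu).le)

theorem mgf_hMeasure (x : ℝ) : ProbabilityTheory.mgf (fun u => -u) hMeasure x =
    ∫ u in Set.Ioi (0 : ℝ), Real.exp (-u) * Gfun 2 u * Real.exp (x * -u) := by
  rw [ProbabilityTheory.mgf, hMeasure, integral_withDensity_eq_integral_toReal_smul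
    measurable_hMeasure_density (by simp)]
  exact setIntegral_congr_fun measurableSet_Ioi fun u hu => by
    simp only [smul_eq_mul]
    rw [toReal_hMeasure_density hu]

theorem mem_interior_integrableExpSet_hMeasure {x : ℝ} (hx : 0 < x) :
    x ∈ interior (ProbabilityTheory.integrableExpSet (fun u => -u) hMeasure) := by
  refine interior_maximal (fun t ht => ?_) isOpen_Ioi (Set.mem_Ioi.2 hx)
  change Integrable (fun u => Real.exp (t * -u)) hMeasure
  rw [hMeasure,
    integrable_withDensity_iff_integrable_smul' measurable_hMeasure_density (by simp)]
  refine (integrableOn_exp_mul_Gfun_two ht).congr_fun (fun u hu => ?_) measurableSet_Ioi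
  simp only [smul_eq_mul]
  rw [toReal_hMeasure_density hu]

theorem ae_hMeasure_pos : ∀ᵐ u ∂hMeasure, 0 < u :=
  (withDensity_absolutelyContinuous _ _).ae_le (ae_restrict_mem measurableSet_Ioi)

theorem completelyMonotonicOn_mgf_hMeasure :
    CompletelyMonotonicOn (ProbabilityTheory.mgf (fun u => -u) hMeasure) := by
  refine ⟨fun x hx => ?_, fun n x hx => ?_⟩
  · exact (ProbabilityTheory.analyticOnNhd_mgf x
      (mem_interior_integrableExpSet_hMeasure hx)).contDiffAt.contDiffWithinAt
  · rw [iteratedDerivWithin_of_isOpen isOpen_Ioi hx,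
      ProbabilityTheory.iteratedDeriv_mgf (mem_interior_integrableExpSet_hMeasure hx),
      ← integral_const_mul]
    refine integral_nonneg_of_ae ?_
    filter_upwards [ae_hMeasure_pos] with u hu
    simp only [Pi.zero_apply]
    rw [← mul_assoc, ← mul_pow]
    simp only [mul_neg, neg_mul, one_mul, neg_neg]
    positivity

theorem CompletelyMonotonicOn.congr {f g : ℝ → ℝ} (hf : CompletelyMonotonicOn f)
    (h : Set.EqOn g f (Set.Ioi 0)) : CompletelyMonotonicOn g := by
  refine ⟨hf.1.congr h, fun n x hx => ?_⟩
  rw [iteratedDerivWithin_congr h hx]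
  exact hf.2 n x hx

/-- `G₂(x) > 0` for all `x > 0`; consequently `−h₂″/h₂′` is completely monotonic on
`(0,∞)`, i.e. `h₂′` is logarithmically completely monotonic. -/
theorem G2_pos_and_h2_logCM :
    (∀ x : ℝ, 0 < x → 0 < Gfun 2 x) ∧
    CompletelyMonotonicOn (fun x => -deriv (deriv (hfun 2)) x / deriv (hfun 2) x) :=
  ⟨fun _ hx => Gfun_two_pos hx, completelyMonotonicOn_mgf_hMeasure.congr fun x hx => by
    rw [mgf_hMeasure]
    exact neg_deriv_deriv_hfun_div_eq_integral hx⟩
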